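/- arXiv:2204.13770 — 2 statements merged into one kernel-verified Lean document; each statement's English description precedes it below -/
import Mathlib

section
/- Let V be a 4-dimensional real vector space and let Ω₁, Ω₂, Ω₃ be alternating 2-forms on V satisfying −Ω₁∧Ω₁ = Ω₂∧Ω₂ = Ω₃∧Ω₃ ≠ 0 and Ωₗ∧Ωₘ = 0 for 1 ≤ l ≠ m ≤ 3. Then there exists a unique quadruple (g, I, S, T) where g is a neutral scalar product on V and I, S, T are endomorphisms of V with I² = −id, S² = T² = id, T = I ∘ S, I ∘ S = −S ∘ I, each of I, S, T g-skew-symmetric, such that Ω₁(u,v) = g(Iu,v), Ω₂(u,v) = g(Su,v) and Ω₃(u,v) = g(Tu,v) for all u, v ∈ V (i.e., (g,I,S,T) is an almost para-hyperhermitian structure with fundamental forms Ω₁, Ω₂, Ω₃). -/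
open Module

/-- A neutral scalar product on a real vector space: a bilinear form admitting a basis
`(e₀,e₁,e₂,e₃)` that is `g`-orthogonal with `g(e₀,e₀)=g(e₁,e₁)=1`, `g(e₂,e₂)=g(e₃,e₃)=-1`
(so in particular the space is 4-dimensional and `g` is symmetric, nondegenerate of
signature (2,2)). -/
def IsNeutral {V : Type*} [AddCommGroup V] [Module ℝ V]
    (g : V →ₗ[ℝ] V →ₗ[ℝ] ℝ) : Prop :=
  ∃ e : Basis (Fin 4) ℝ V,
    (∀ i j, i ≠ j → g (e i) (e j) = 0) ∧
    g (e 0) (e 0) = 1 ∧ g (e 1) (e 1) = 1 ∧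
    g (e 2) (e 2) = -1 ∧ g (e 3) (e 3) = -1

/-- The wedge product of two (alternating) 2-forms, as a 4-form: the sum over the
(2,2)-shuffles with signs. -/
def wedge {V : Type*} [AddCommGroup V] [Module ℝ V]
    (φ ψ : V → V → ℝ) (v₁ v₂ v₃ v₄ : V) : ℝ :=
  φ v₁ v₂ * ψ v₃ v₄ - φ v₁ v₃ * ψ v₂ v₄ + φ v₁ v₄ * ψ v₂ v₃
    + φ v₂ v₃ * ψ v₁ v₄ - φ v₂ v₄ * ψ v₁ v₃ + φ v₃ v₄ * ψ v₁ v₂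

section Helpers

variable {V : Type*} [AddCommGroup V] [Module ℝ V]

/-- Antisymmetry of an alternating form. -/
lemma alt_swap (A : V →ₗ[ℝ] V →ₗ[ℝ] ℝ) (hA : ∀ v, A v v = 0) (u v : V) :
    A u v = - A v u := by
  have h := hA (u + v)
  simp only [map_add, LinearMap.add_apply, hA] at h
  linarith

/-- Coefficients of a vector killed by `A ∧ A` vanish. -/
lemma coeff_zero (A : V →ₗ[ℝ] V →ₗ[ℝ] ℝ) (hA : ∀ v, A v v = 0) (v : Fin 4 → V)
    (hv : wedge (fun u v => A u v) (fun u v => A u v) (v 0) (v 1) (v 2) (v 3) ≠ 0)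
    (c : Fin 4 → ℝ)
    (hw : ∀ x y z, wedge (fun u v => A u v) (fun u v => A u v) (∑ i, c i • v i) x y z = 0) :
    ∀ i, c i = 0 := by
  have e0 := hw (v 1) (v 2) (v 3)
  have e1 := hw (v 0) (v 2) (v 3)
  have e2 := hw (v 0) (v 1) (v 3)
  have e3 := hw (v 0) (v 1) (v 2)
  simp only [wedge, Fin.sum_univ_four, map_add, map_smul, LinearMap.add_apply,
    LinearMap.smul_apply, smul_eq_mul, hA, alt_swap A hA (v 1) (v 0), alt_swap A hA (v 2) (v 0),
    alt_swap A hA (v 3) (v 0), alt_swap A hA (v 2) (v 1), alt_swap A hA (v 3) (v 1),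
    alt_swap A hA (v 3) (v 2)] at e0 e1 e2 e3 hv
  intro i
  refine (mul_eq_zero.mp (?_ : c i * _ = 0)).resolve_right hv
  fin_cases i
  · simp only [Fin.zero_eta]; linear_combination e0
  · simp only [Fin.mk_one]; linear_combination -e1
  · simp only [Fin.reduceFinMk]; linear_combination e2
  · simp only [Fin.reduceFinMk]; linear_combination -e3

lemma wedge_nondeg (hdim : finrank ℝ V = 4) (A : V →ₗ[ℝ] V →ₗ[ℝ] ℝ) (hA : ∀ v, A v v = 0)
    (hne : ∃ v₁ v₂ v₃ v₄, wedge (fun u v => A u v) (fun u v => A u v) v₁ v₂ v₃ v₄ ≠ 0)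
    (w : V) (hw : ∀ x y z, wedge (fun u v => A u v) (fun u v => A u v) w x y z = 0) :
    w = 0 := by
  obtain ⟨v₁, v₂, v₃, v₄, hv⟩ := hne
  have key := coeff_zero A hA ![v₁, v₂, v₃, v₄] hv
  have hli : LinearIndependent ℝ ![v₁, v₂, v₃, v₄] := by
    rw [Fintype.linearIndependent_iff]
    intro c hc
    apply key c
    intro x y z
    rw [hc]
    simp [wedge]
  let b := basisOfLinearIndependentOfCardEqFinrank hli (by simp [hdim])
  have hb : ∀ i, b i = ![v₁, v₂, v₃, v₄] i := fun i => by simp [b]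
  have hr := b.sum_repr w
  have h0 := key (fun i => b.repr w i) (by
    intro x y z
    have : ∑ i, b.repr w i • ![v₁, v₂, v₃, v₄] i = w := by
      rw [← hr]; simp only [← hb, hr]
    rw [this]; exact hw x y z)
  rw [← hr]
  simp [h0]

lemma form_nondeg (hdim : finrank ℝ V = 4) (A : V →ₗ[ℝ] V →ₗ[ℝ] ℝ) (hA : ∀ v, A v v = 0)
    (hne : ∃ v₁ v₂ v₃ v₄, wedge (fun u v => A u v) (fun u v => A u v) v₁ v₂ v₃ v₄ ≠ 0)
    (w : V) (hw : ∀ x, A w x = 0) : w = 0 := by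
  apply wedge_nondeg hdim A hA hne
  intro x y z
  simp [wedge, hw]

lemma exists_endo (hdim : finrank ℝ V = 4) (A : V →ₗ[ℝ] V →ₗ[ℝ] ℝ)
    (hA : ∀ w, (∀ x, A w x = 0) → w = 0) (B : V →ₗ[ℝ] V →ₗ[ℝ] ℝ) :
    ∃ N : V →ₗ[ℝ] V, ∀ u v, A (N u) v = B u v := by
  have : FiniteDimensional ℝ V := FiniteDimensional.of_finrank_pos (by omega)
  have hinj : Function.Injective A := by
    rw [injective_iff_map_eq_zero]
    intro a ha
    exact hA a (fun x => by rw [ha]; rfl)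
  let e : V ≃ₗ[ℝ] (V →ₗ[ℝ] ℝ) := LinearEquiv.ofInjectiveOfFinrankEq A hinj
    (Subspace.dual_finrank_eq (K := ℝ) (V := V)).symm
  refine ⟨e.symm.toLinearMap ∘ₗ B, fun u v => ?_⟩
  have : e (e.symm (B u)) = B u := e.apply_symm_apply _
  have h2 : A (e.symm (B u)) = B u := this
  simp [h2]

/-- The neutral basis. -/
lemma neutral_of (hdim : finrank ℝ V = 4) (g : V →ₗ[ℝ] V →ₗ[ℝ] ℝ) (I S T : V →ₗ[ℝ] V)
    (hsym : ∀ u v, g u v = g v u) (hg : ∃ u v, g u v ≠ 0)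
    (hI : ∀ v, I (I v) = -v) (hS : ∀ v, S (S v) = v)
    (hT : ∀ v, T v = I (S v)) (hTT : ∀ v, T (T v) = v)
    (gI : ∀ u v, g (I u) v = - g u (I v)) (gS : ∀ u v, g (S u) v = - g u (S v))
    (gT : ∀ u v, g (T u) v = - g u (T v)) : IsNeutral g := by
  have h1 : ∃ e, g e e ≠ 0 := by
    by_contra! h
    obtain ⟨u, v, huv⟩ := hg
    apply huv
    have := alt_swap g h u v
    have := hsym u v
    linarith
  have h2 : ∃ e, 0 < g e e := by
    obtain ⟨e, he⟩ := h1
    rcases lt_or_gt_of_ne he with h | h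
    · refine ⟨S e, ?_⟩
      rw [gS, hS]; linarith
    · exact ⟨e, h⟩
  have h3 : ∃ e, g e e = 1 := by
    obtain ⟨e, he⟩ := h2
    refine ⟨(√(g e e))⁻¹ • e, ?_⟩
    have hs : √(g e e) * √(g e e) = g e e := Real.mul_self_sqrt he.le
    have hp : √(g e e) ≠ 0 := (Real.sqrt_pos.mpr he).ne'
    simp only [map_smul, LinearMap.smul_apply, smul_eq_mul]
    field_simp
    nlinarith
  obtain ⟨e, he⟩ := h3
  have sk : ∀ (N : V →ₗ[ℝ] V), (∀ u v, g (N u) v = - g u (N v)) → ∀ v, g v (N v) = 0 := by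
    intro N hN v
    have a := hN v v
    have b := hsym (N v) v
    linarith
  have eI := sk I gI e
  have eS := sk S gS e
  have eT := sk T gT e
  have II : g (I e) (I e) = 1 := by rw [gI, hI, map_neg, he]; norm_num
  have SS : g (S e) (S e) = -1 := by rw [gS, hS, he]
  have TT : g (T e) (T e) = -1 := by rw [gT, hTT, he]
  have IS : g (I e) (S e) = 0 := by rw [gI, ← hT, eT]; norm_num
  have IT : g (I e) (T e) = 0 := by rw [gI, hT, hI, map_neg, eS]; norm_num
  have ST : g (S e) (T e) = 0 := by rw [hT]; exact sk I gI (S e)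
  have orth : ∀ i j : Fin 4, i ≠ j → g (![e, I e, S e, T e] i) (![e, I e, S e, T e] j) = 0 := by
    intro i j hij
    fin_cases i <;> fin_cases j <;>
      first
      | exact absurd rfl hij
      | assumption
      | (rw [hsym]; assumption)
  have diag : ∀ i : Fin 4, g (![e, I e, S e, T e] i) (![e, I e, S e, T e] i) ≠ 0 := by
    intro i
    fin_cases i <;> simp [he, II, SS, TT]
  have hli : LinearIndependent ℝ ![e, I e, S e, T e] := by
    rw [Fintype.linearIndependent_iff]
    intro c hc i
    have h := congrArg (g (![e, I e, S e, T e] i)) hc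
    rw [map_sum, map_zero, Finset.sum_eq_single i] at h
    · rw [map_smul, smul_eq_mul] at h
      exact (mul_eq_zero.mp h).resolve_right (diag i)
    · intro j _ hj
      rw [map_smul, orth i j hj.symm, smul_zero]
    · simp
  let b := basisOfLinearIndependentOfCardEqFinrank hli (by simp [hdim])
  have hb : ∀ i, b i = ![e, I e, S e, T e] i := fun i => by simp [b]
  refine ⟨b, ?_, ?_, ?_, ?_, ?_⟩
  · intro i j hij
    rw [hb, hb]; exact orth i j hij
  all_goals
    rw [hb]
    assumption

end Helpers

/-- Proposition 1 (Kamada): three alternating 2-forms `Ω₁, Ω₂, Ω₃` on a 4-dimensional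
real vector space with `-Ω₁² = Ω₂² = Ω₃² ≠ 0` and `Ωₗ ∧ Ωₘ = 0` for `l ≠ m` uniquely
determine an almost para-hyperhermitian structure `(g, I, S, T)` whose fundamental
2-forms they are. -/
theorem unique_para_hyperhermitian_from_forms {V : Type*} [AddCommGroup V] [Module ℝ V]
    (hdim : finrank ℝ V = 4)
    (Ω₁ Ω₂ Ω₃ : V →ₗ[ℝ] V →ₗ[ℝ] ℝ)
    (halt₁ : ∀ v, Ω₁ v v = 0) (halt₂ : ∀ v, Ω₂ v v = 0) (halt₃ : ∀ v, Ω₃ v v = 0)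
    (h11 : ∀ v₁ v₂ v₃ v₄, -(wedge (fun u v => Ω₁ u v) (fun u v => Ω₁ u v) v₁ v₂ v₃ v₄)
      = wedge (fun u v => Ω₂ u v) (fun u v => Ω₂ u v) v₁ v₂ v₃ v₄)
    (h22 : ∀ v₁ v₂ v₃ v₄, wedge (fun u v => Ω₂ u v) (fun u v => Ω₂ u v) v₁ v₂ v₃ v₄
      = wedge (fun u v => Ω₃ u v) (fun u v => Ω₃ u v) v₁ v₂ v₃ v₄)
    (hne : ∃ v₁ v₂ v₃ v₄, wedge (fun u v => Ω₂ u v) (fun u v => Ω₂ u v) v₁ v₂ v₃ v₄ ≠ 0)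
    (h12 : ∀ v₁ v₂ v₃ v₄, wedge (fun u v => Ω₁ u v) (fun u v => Ω₂ u v) v₁ v₂ v₃ v₄ = 0)
    (h21 : ∀ v₁ v₂ v₃ v₄, wedge (fun u v => Ω₂ u v) (fun u v => Ω₁ u v) v₁ v₂ v₃ v₄ = 0)
    (h13 : ∀ v₁ v₂ v₃ v₄, wedge (fun u v => Ω₁ u v) (fun u v => Ω₃ u v) v₁ v₂ v₃ v₄ = 0)
    (h31 : ∀ v₁ v₂ v₃ v₄, wedge (fun u v => Ω₃ u v) (fun u v => Ω₁ u v) v₁ v₂ v₃ v₄ = 0)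
    (h23 : ∀ v₁ v₂ v₃ v₄, wedge (fun u v => Ω₂ u v) (fun u v => Ω₃ u v) v₁ v₂ v₃ v₄ = 0)
    (h32 : ∀ v₁ v₂ v₃ v₄, wedge (fun u v => Ω₃ u v) (fun u v => Ω₂ u v) v₁ v₂ v₃ v₄ = 0) :
    ∃! q : (V →ₗ[ℝ] V →ₗ[ℝ] ℝ) × (V →ₗ[ℝ] V) × (V →ₗ[ℝ] V) × (V →ₗ[ℝ] V),
      IsNeutral q.1 ∧
      (∀ v, q.2.1 (q.2.1 v) = -v) ∧
      (∀ v, q.2.2.1 (q.2.2.1 v) = v) ∧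
      (∀ v, q.2.2.2 (q.2.2.2 v) = v) ∧
      (∀ v, q.2.2.2 v = q.2.1 (q.2.2.1 v)) ∧
      (∀ v, q.2.1 (q.2.2.1 v) = - q.2.2.1 (q.2.1 v)) ∧
      (∀ u v, q.1 (q.2.1 u) v = - q.1 u (q.2.1 v)) ∧
      (∀ u v, q.1 (q.2.2.1 u) v = - q.1 u (q.2.2.1 v)) ∧
      (∀ u v, q.1 (q.2.2.2 u) v = - q.1 u (q.2.2.2 v)) ∧
      (∀ u v, Ω₁ u v = q.1 (q.2.1 u) v) ∧
      (∀ u v, Ω₂ u v = q.1 (q.2.2.1 u) v) ∧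
      (∀ u v, Ω₃ u v = q.1 (q.2.2.2 u) v) := by
  have hne1 : ∃ v₁ v₂ v₃ v₄,
      wedge (fun u v => Ω₁ u v) (fun u v => Ω₁ u v) v₁ v₂ v₃ v₄ ≠ 0 := by
    obtain ⟨a, b, c, d, h⟩ := hne
    refine ⟨a, b, c, d, fun h0 => h ?_⟩
    rw [← h11, h0, neg_zero]
  have nd := form_nondeg hdim Ω₁ halt₁ hne1
  have wnd := wedge_nondeg hdim Ω₁ halt₁ hne1
  have inj : ∀ a b, (∀ x, Ω₁ a x = Ω₁ b x) → a = b := by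
    intro a b h
    apply sub_eq_zero.mp
    apply nd
    intro x
    simp [h]
  obtain ⟨S, hS⟩ := exists_endo hdim Ω₁ nd Ω₃
  obtain ⟨T, hT⟩ := exists_endo hdim Ω₁ nd (-Ω₂)
  have hT' : ∀ u v, Ω₂ u v = - Ω₁ (T u) v := fun u v => by rw [hT]; simp
  have hS' : ∀ u v, Ω₃ u v = Ω₁ (S u) v := fun u v => (hS u v).symm
  have a1 := alt_swap Ω₁ halt₁
  have a2 := alt_swap Ω₂ halt₂
  have a3 := alt_swap Ω₃ halt₃
  have SS : ∀ v, S (S v) = v := by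
    intro u
    apply sub_eq_zero.mp
    apply wnd
    intro x y z
    have e1 := h13 (S u) x y z
    have e2 := h11 u x y z
    have e3 := h22 u x y z
    rw [e3] at e2
    simp only [wedge, map_sub, LinearMap.sub_apply] at *
    simp only [hS'] at *
    linear_combination 2 * e1 + e2
  have TT : ∀ v, T (T v) = v := by
    intro u
    apply sub_eq_zero.mp
    apply wnd
    intro x y z
    have e1 := h12 (T u) x y z
    have e2 := h11 u x y z
    simp only [wedge, map_sub, LinearMap.sub_apply] at *
    simp only [hT'] at *
    linear_combination -2 * e1 + e2
  have ST : ∀ v, T (S v) = - S (T v) := by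
    intro u
    apply eq_neg_of_add_eq_zero_left
    apply wnd
    intro x y z
    have e1 := h12 (S u) x y z
    have e2 := h13 (T u) x y z
    have e3 := h23 u x y z
    simp only [wedge, map_add, LinearMap.add_apply] at *
    simp only [hT', hS'] at *
    linear_combination -2 * e1 + 2 * e2 + 2 * e3
  have sS : ∀ u v, Ω₁ (S u) v = Ω₁ u (S v) := fun u v => by
    rw [← hS', a3, hS', ← a1]
  have sT : ∀ u v, Ω₁ (T u) v = Ω₁ u (T v) := fun u v => by
    have h1 := hT' u v
    have h2 := hT' v u
    have h3 := a2 u v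
    have h4 := a1 u (T v)
    linarith
  have ST' : ∀ v, S (T v) = - T (S v) := fun v => by rw [ST, neg_neg]
  refine ⟨(-(Ω₁ ∘ₗ (T ∘ₗ S)), T ∘ₗ S, S, T), ?_, ?_⟩
  · have gsym : ∀ u v, (-(Ω₁ ∘ₗ (T ∘ₗ S))) u v = (-(Ω₁ ∘ₗ (T ∘ₗ S))) v u := by
      intro u v
      simp only [LinearMap.neg_apply, LinearMap.comp_apply]
      rw [sT, sS, ST', map_neg, a1, neg_neg]
    have f1 : ∀ v, (T ∘ₗ S) ((T ∘ₗ S) v) = -v := by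
      intro v
      simp only [LinearMap.comp_apply]
      rw [ST', map_neg, TT, SS]
    have f4 : ∀ v, T v = (T ∘ₗ S) (S v) := by
      intro v
      simp only [LinearMap.comp_apply, SS]
    have g1 : ∀ u v, Ω₁ u v = (-(Ω₁ ∘ₗ (T ∘ₗ S))) ((T ∘ₗ S) u) v := by
      intro u v
      rw [LinearMap.neg_apply, LinearMap.comp_apply, f1]
      simp
    have g2 : ∀ u v, Ω₂ u v = (-(Ω₁ ∘ₗ (T ∘ₗ S))) (S u) v := by
      intro u v
      rw [LinearMap.neg_apply, LinearMap.comp_apply, ← f4, hT']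
      simp
    have g3 : ∀ u v, Ω₃ u v = (-(Ω₁ ∘ₗ (T ∘ₗ S))) (T u) v := by
      intro u v
      simp only [LinearMap.neg_apply, LinearMap.comp_apply]
      rw [ST', map_neg, TT, hS']
      simp
    have k1 : ∀ u v, (-(Ω₁ ∘ₗ (T ∘ₗ S))) ((T ∘ₗ S) u) v
        = -(-(Ω₁ ∘ₗ (T ∘ₗ S))) u ((T ∘ₗ S) v) := by
      intro u v
      rw [← g1, gsym u, ← g1, a1]
    have k2 : ∀ u v, (-(Ω₁ ∘ₗ (T ∘ₗ S))) (S u) v = -(-(Ω₁ ∘ₗ (T ∘ₗ S))) u (S v) := by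
      intro u v
      rw [← g2, gsym u, ← g2, a2]
    have k3 : ∀ u v, (-(Ω₁ ∘ₗ (T ∘ₗ S))) (T u) v = -(-(Ω₁ ∘ₗ (T ∘ₗ S))) u (T v) := by
      intro u v
      rw [← g3, gsym u, ← g3, a3]
    have gne : ∃ u v, (-(Ω₁ ∘ₗ (T ∘ₗ S))) u v ≠ 0 := by
      by_contra! h
      obtain ⟨a, b, c, d, h0⟩ := hne1
      apply h0
      simp only [wedge, g1, h]
      norm_num
    refine ⟨neutral_of hdim _ (T ∘ₗ S) S T gsym gne f1 SS f4 TT k1 k2 k3,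
      f1, SS, TT, f4, ?_, k1, k2, k3, g1, g2, g3⟩
    intro v
    simp only [LinearMap.comp_apply]
    rw [ST' (S v), neg_neg]
  · rintro ⟨g, I', S', T'⟩ ⟨-, p1, p2, p3, p4, p5, -, -, -, q1, q2, q3⟩
    simp only at p1 p2 p3 p4 p5 q1 q2 q3
    have rS : S' = S := by
      ext u
      apply inj
      intro x
      rw [q1, ← p4, ← q3, hS]
    have rT : T' = T := by
      ext u
      apply inj
      intro x
      rw [q1, p4, p1, map_neg, LinearMap.neg_apply, ← q2, hT]
      simp
    have rI : I' = T ∘ₗ S := by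
      ext u
      rw [LinearMap.comp_apply, ← rT, ← rS, p4, p2]
    have rg : g = -(Ω₁ ∘ₗ (T ∘ₗ S)) := by
      ext u v
      rw [← rI, LinearMap.neg_apply, LinearMap.comp_apply, LinearMap.neg_apply, q1, p1]
      simp
    rw [rS, rT, rI, rg]
end

section
/- Let V be a 4-dimensional real vector space and I a complex structure on V. Then V admits an almost para-hyperhermitian structure (g, I, S, T) whose first structure is the given I if and only if there exist a complex-valued alternating 2-form Ω on V of type (2,0) with respect to I (i.e., Ω(Iu,v) = i·Ω(u,v) for all u,v) and a nondegenerate real alternating 2-form ω on V such that Ω∧Ω̄ = −2 ω∧ω and Ω∧ω = 0. Moreover, if Ω and ω satisfy these conditions, then the almost para-hyperhermitian structure (g,I,S,T) can be chosen so that its fundamental 2-forms are ω = g(I·,·), Re Ω = g(S·,·) and Im Ω = g(T·,·). -/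
open Module

/-- The wedge product of two complex-valued (alternating) 2-forms, as a 4-form:
the sum over the (2,2)-shuffles with signs. -/
def wedgeC {V : Type*} (φ ψ : V → V → ℂ) (v₁ v₂ v₃ v₄ : V) : ℂ :=
  φ v₁ v₂ * ψ v₃ v₄ - φ v₁ v₃ * ψ v₂ v₄ + φ v₁ v₄ * ψ v₂ v₃
    + φ v₂ v₃ * ψ v₁ v₄ - φ v₂ v₄ * ψ v₁ v₃ + φ v₃ v₄ * ψ v₁ v₂

/-- `(g, I, S, T)` is an almost para-hyperhermitian structure: `g` is a neutral scalar
product, `I² = -id`, `S² = T² = id`, `T = IS`, `IS = -SI`, and `I, S, T` are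
`g`-skew-symmetric. -/
def IsAPHH {V : Type*} [AddCommGroup V] [Module ℝ V]
    (g : V →ₗ[ℝ] V →ₗ[ℝ] ℝ) (I S T : V →ₗ[ℝ] V) : Prop :=
  IsNeutral g ∧
  (∀ v, I (I v) = -v) ∧ (∀ v, S (S v) = v) ∧ (∀ v, T (T v) = v) ∧
  (∀ v, T v = I (S v)) ∧ (∀ v, I (S v) = - S (I v)) ∧
  (∀ u v, g (I u) v = - g u (I v)) ∧
  (∀ u v, g (S u) v = - g u (S v)) ∧
  (∀ u v, g (T u) v = - g u (T v))

/-- The conditions of Lemma 2 (`APHHS`) on the pair of forms `(Ω, ω)`: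
`Ω` is a complex-valued alternating 2-form of type `(2,0)` w.r.t. `I`, `ω` is a
nondegenerate real alternating 2-form, `Ω ∧ Ω̄ = -2 ω²` and `Ω ∧ ω = 0`. -/
def FormsCond {V : Type*} [AddCommGroup V] [Module ℝ V] (I : V →ₗ[ℝ] V)
    (Ω : V →ₗ[ℝ] V →ₗ[ℝ] ℂ) (ω : V →ₗ[ℝ] V →ₗ[ℝ] ℝ) : Prop :=
  (∀ v, Ω v v = 0) ∧
  (∀ u v, Ω (I u) v = Complex.I * Ω u v) ∧
  (∀ v, ω v v = 0) ∧
  (∀ u, (∀ v, ω u v = 0) → u = 0) ∧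
  (∀ v₁ v₂ v₃ v₄,
    wedgeC (fun u v => Ω u v) (fun u v => starRingEnd ℂ (Ω u v)) v₁ v₂ v₃ v₄
      = -2 * wedgeC (fun u v => (ω u v : ℂ)) (fun u v => (ω u v : ℂ)) v₁ v₂ v₃ v₄) ∧
  (∀ v₁ v₂ v₃ v₄,
    wedgeC (fun u v => Ω u v) (fun u v => (ω u v : ℂ)) v₁ v₂ v₃ v₄ = 0)

section helpers

variable {V : Type*} [AddCommGroup V] [Module ℝ V]

lemma aph_basis (hdim : finrank ℝ V = 4) (g : V →ₗ[ℝ] V →ₗ[ℝ] ℝ) (I S T : V →ₗ[ℝ] V)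
    (hs : ∀ u v, g u v = g v u)
    (hI : ∀ v, I (I v) = -v) (hS : ∀ v, S (S v) = v)
    (hT : ∀ v, T v = I (S v)) (hIS : ∀ v, I (S v) = - S (I v))
    (kI : ∀ u v, g (I u) v = - g u (I v))
    (kS : ∀ u v, g (S u) v = - g u (S v))
    (e : V) (he : g e e = 1) :
    ∃ b : Basis (Fin 4) ℝ V, b 0 = e ∧ b 1 = I e ∧ b 2 = S e ∧ b 3 = T e ∧
      (∀ i j, i ≠ j → g (b i) (b j) = 0) ∧
      g (b 0) (b 0) = 1 ∧ g (b 1) (b 1) = 1 ∧ g (b 2) (b 2) = -1 ∧ g (b 3) (b 3) = -1 := by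
  have kT : ∀ u v, g (T u) v = - g u (T v) := by
    intro u v
    rw [hT, hT, kI, kS, hIS]; simp
  have zI : ∀ u, g u (I u) = 0 := fun u => by have := kI u u; rw [hs] at this; linarith
  have zS : ∀ u, g u (S u) = 0 := fun u => by have := kS u u; rw [hs] at this; linarith
  have zT : ∀ u, g u (T u) = 0 := fun u => by have := kT u u; rw [hs] at this; linarith
  have h11 : g (I e) (I e) = 1 := by rw [kI, hI]; simp [he]
  have h22 : g (S e) (S e) = -1 := by rw [kS, hS]; simp [he]
  have h33 : g (T e) (T e) = -1 := by rw [hT, kI, hI]; simp [h22]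
  have h12 : g (I e) (S e) = 0 := by rw [kI, ← hT, zT]; simp
  have h13 : g (I e) (T e) = 0 := by rw [hT, kI, hI]; simp [zS]
  have h23 : g (S e) (T e) = 0 := by rw [hT, zI]
  have h01 := zI e
  have h02 := zS e
  have h03 := zT e
  have h10 := (hs _ _).trans h01
  have h20 := (hs _ _).trans h02
  have h30 := (hs _ _).trans h03
  have h21 := (hs _ _).trans h12
  have h31 := (hs _ _).trans h13
  have h32 := (hs _ _).trans h23
  have li : LinearIndependent ℝ ![e, I e, S e, T e] := by
    rw [Fintype.linearIndependent_iff]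
    intro c hc
    simp only [Fin.sum_univ_four] at hc
    simp at hc
    have c0 := congrArg (g e) hc
    have c1 := congrArg (g (I e)) hc
    have c2 := congrArg (g (S e)) hc
    have c3 := congrArg (g (T e)) hc
    simp only [map_add, map_smul, smul_eq_mul, map_zero, he, h11, h22, h33, h01, h02, h03, h10,
      h12, h13, h20, h21, h23, h30, h31, h32] at c0 c1 c2 c3
    intro i
    fin_cases i <;> simp only [Fin.zero_eta, Fin.mk_one, Fin.reduceFinMk] <;> linarith
  let b := basisOfLinearIndependentOfCardEqFinrank li (by simp [hdim])
  have b0 : b 0 = e := by simp [b]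
  have b1 : b 1 = I e := by simp [b]
  have b2 : b 2 = S e := by simp [b]
  have b3 : b 3 = T e := by simp [b]
  refine ⟨b, b0, b1, b2, b3, ?_, ?_, ?_, ?_, ?_⟩
  · intro i j hij
    fin_cases i <;> fin_cases j <;> first | exact absurd rfl hij | skip
    all_goals simp only [Fin.zero_eta, Fin.mk_one, Fin.reduceFinMk, b0, b1, b2, b3]
    all_goals assumption
  · rw [b0, he]
  · rw [b1, h11]
  · rw [b2, h22]
  · rw [b3, h33]

/-- Nondegeneracy of `Ω`. -/
lemma Om_nondeg (hdim : finrank ℝ V = 4) (I : V →ₗ[ℝ] V) (hI : ∀ v, I (I v) = -v)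
    (Ω : V →ₗ[ℝ] V →ₗ[ℝ] ℂ) (ω : V →ₗ[ℝ] V →ₗ[ℝ] ℝ) (h : FormsCond I Ω ω)
    (u : V) (hu : ∀ v, Ω u v = 0) : u = 0 := by
  obtain ⟨hΩa, hΩI, hωa, hωn, hw1, -⟩ := h
  have fd : FiniteDimensional ℝ V := Module.finite_of_finrank_pos (by omega)
  have key : ∀ v w, ω u (I u) * ω v w - ω u v * ω (I u) w + ω u w * ω (I u) v = 0 := by
    intro v w
    have := hw1 u (I u) v w
    simp only [wedgeC, hΩI, hu] at this
    have := congrArg Complex.re this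
    simp at this
    linarith
  have sw : ∀ a b, ω a b = - ω b a := by
    intro a b
    have := hωa (a + b)
    simp [hωa] at this
    linarith
  by_cases hp : ω u (I u) = 0
  · by_contra hu0
    obtain ⟨v, hv⟩ : ∃ v, ω u v ≠ 0 := by
      by_contra! hc
      exact hu0 (hωn u hc)
    have h1 : I u - (ω (I u) v / ω u v) • u = 0 := by
      apply hωn
      intro w
      have := key v w
      simp
      field_simp
      rw [hp] at this
      linarith
    set c := ω (I u) v / ω u v with hc
    have h2 : I u = c • u := sub_eq_zero.mp h1
    have h3 := hI u
    rw [h2, map_smul, h2, smul_smul] at h3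
    have h4 : (c * c + 1) • u = 0 := by rw [add_smul, h3]; simp
    rcases smul_eq_zero.mp h4 with h5 | h5
    · nlinarith [mul_self_nonneg c]
    · exact hu0 h5
  · exfalso
    let L : V →ₗ[ℝ] (ℝ × ℝ) := (ω u).prod (ω (I u))
    have hk : LinearMap.ker L ≠ ⊥ := by
      apply LinearMap.ker_ne_bot_of_finrank_lt
      simp [hdim]
    obtain ⟨v, hv, hv0⟩ := (Submodule.ne_bot_iff _).mp hk
    have hv' : ω u v = 0 ∧ ω (I u) v = 0 := by simpa [L] using hv
    apply hv0
    apply hωn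
    intro w
    have := key v w
    rw [hv'.1, hv'.2] at this
    simpa [hp] using this

lemma om_type (hdim : finrank ℝ V = 4) (I : V →ₗ[ℝ] V) (hI : ∀ v, I (I v) = -v)
    (Ω : V →ₗ[ℝ] V →ₗ[ℝ] ℂ) (ω : V →ₗ[ℝ] V →ₗ[ℝ] ℝ) (h : FormsCond I Ω ω)
    (u v : V) : ω (I u) (I v) = ω u v := by
  have nd := Om_nondeg hdim I hI Ω ω h
  obtain ⟨hΩa, hΩI, hωa, hωn, hw1, hw2⟩ := h
  have sw : ∀ a b, Ω a b = - Ω b a := by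
    intro a b
    have := hΩa (a + b)
    simp [hΩa] at this
    linear_combination this
  have hΩI' : ∀ a b, Ω a (I b) = Complex.I * Ω a b := by
    intro a b
    rw [sw, hΩI, sw b a]; ring
  have key : ∀ u v, Ω u v ≠ 0 → ω (I u) (I v) = ω u v := by
    intro u v huv
    have := hw2 u (I u) v (I v)
    simp only [wedgeC, hΩI, hΩI', hΩa] at this
    have h2 : Ω u v * (- ω (I u) (I v) + Complex.I * ω (I u) v + Complex.I * ω u (I v)
        + ω u v) = 0 := by
      linear_combination this + (Ω u v * ω u v) * Complex.I_mul_I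
    have h3 := (mul_eq_zero.mp h2).resolve_left huv
    have := congrArg Complex.re h3
    simp at this
    linarith
  by_cases hu : u = 0
  · simp [hu]
  obtain ⟨w, hw⟩ : ∃ w, Ω u w ≠ 0 := by
    by_contra! hc
    exact hu (nd u hc)
  by_cases huv : Ω u v = 0
  · have h1 := key u w hw
    have h2 := key u (v + w) (by simpa [huv] using hw)
    simp at h2
    linarith
  · exact key u v huv

lemma forms_to_aph (hdim : finrank ℝ V = 4) (I : V →ₗ[ℝ] V) (hI : ∀ v, I (I v) = -v)
    (Ω : V →ₗ[ℝ] V →ₗ[ℝ] ℂ) (ω : V →ₗ[ℝ] V →ₗ[ℝ] ℝ) (h : FormsCond I Ω ω) :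
    ∃ g S T, IsAPHH g I S T ∧
        (∀ u v, ω u v = g (I u) v) ∧
        (∀ u v, (Ω u v).re = g (S u) v) ∧
        (∀ u v, (Ω u v).im = g (T u) v) := by
  have fd : FiniteDimensional ℝ V := Module.finite_of_finrank_pos (by omega)
  have nd := Om_nondeg hdim I hI Ω ω h
  have ty := om_type hdim I hI Ω ω h
  obtain ⟨hΩa, hΩI, hωa, hωn, hw1, hw2⟩ := h
  have sw : ∀ a b, Ω a b = - Ω b a := by
    intro a b
    have := hΩa (a + b)
    simp [hΩa] at this
    linear_combination this
  have hΩI' : ∀ a b, Ω a (I b) = Complex.I * Ω a b := by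
    intro a b
    rw [sw, hΩI, sw b a]; ring
  have swo : ∀ a b, ω a b = - ω b a := by
    intro a b
    have := hωa (a + b)
    simp [hωa] at this
    linarith
  let g : V →ₗ[ℝ] V →ₗ[ℝ] ℝ := -(ω ∘ₗ I)
  have gd : ∀ u v, g u v = - ω (I u) v := fun u v => by simp [g]
  have og : ∀ u v, ω u v = g (I u) v := fun u v => by rw [gd, hI]; simp
  have hs : ∀ u v, g u v = g v u := by
    intro u v
    rw [gd, gd, ← ty (I u) v, hI, swo (I v) u]; simp
  have kI : ∀ u v, g (I u) v = - g u (I v) := by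
    intro u v
    rw [gd, gd, ty, hI]; simp
  have gn : ∀ u, (∀ v, g u v = 0) → u = 0 := by
    intro u hu
    have : I u = 0 := hωn _ fun v => by have := hu v; rw [gd] at this; linarith
    have h2 := hI u
    rw [this] at h2
    simpa using h2.symm
  have gext : ∀ u u', (∀ v, g u v = g u' v) → u = u' := by
    intro u u' hh
    rw [← sub_eq_zero]
    apply gn
    intro v
    simp [hh]
  have inj : Function.Injective g := by
    intro a b hab
    exact gext a b fun v => by rw [hab]
  let G : V ≃ₗ[ℝ] (V →ₗ[ℝ] ℝ) :=
    LinearEquiv.ofInjectiveOfFinrankEq g inj (Subspace.dual_finrank_eq (K := ℝ) (V := V)).symm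
  have hG : ∀ φ v, g (G.symm φ) v = φ v := by
    intro φ v
    have : G (G.symm φ) = φ := by simp
    exact congrArg (fun f : V →ₗ[ℝ] ℝ => f v) this
  let S : V →ₗ[ℝ] V := G.symm.toLinearMap ∘ₗ (Ω.compr₂ Complex.reLm)
  have hSd : ∀ u v, g (S u) v = (Ω u v).re := by
    intro u v
    simp [S, hG]
  let T : V →ₗ[ℝ] V := I ∘ₗ S
  have hT : ∀ v, T v = I (S v) := fun v => rfl
  have hTd : ∀ u v, g (T u) v = (Ω u v).im := by
    intro u v
    rw [hT, kI, hSd, hΩI']; simp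
  have kS : ∀ u v, g (S u) v = - g u (S v) := by
    intro u v
    rw [hs u, hSd, hSd, sw]; simp
  have kT : ∀ u v, g (T u) v = - g u (T v) := by
    intro u v
    rw [hs u, hTd, hTd, sw]; simp
  have hIS : ∀ v, I (S v) = - S (I v) := by
    intro v
    apply gext
    intro w
    rw [← hT, hTd]
    simp [hSd, hΩI]
  have zI : ∀ u, g u (I u) = 0 := fun u => by have := kI u u; rw [hs] at this; linarith
  have zS : ∀ u, g u (S u) = 0 := fun u => by have := kS u u; rw [hs] at this; linarith
  have zT : ∀ u, g u (T u) = 0 := fun u => by have := kT u u; rw [hs] at this; linarith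
  have star : ∀ u v, g (S u) v ^ 2 + g (T u) v ^ 2
      = g (I u) v ^ 2 + g u v ^ 2 - g u u * g v v := by
    intro u v
    have := hw1 u (I u) v (I v)
    simp only [wedgeC, hΩI, hΩI', hΩa] at this
    have := congrArg Complex.re this
    simp [og, hI] at this
    rw [hSd, hTd]
    have e1 : g (I u) (I v) = g u v := by rw [kI, hI]; simp
    have e2 : ∀ u, g (I u) (I u) = g u u := fun u => by rw [kI, hI]; simp
    have e3 : g u (I v) = - g (I u) v := by rw [kI]; simp
    simp only [e1, e2, e3] at this
    nlinarith [this]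
  have pol : ∀ u v w, g (S u) v * g (S u) w + g (T u) v * g (T u) w
      = g (I u) v * g (I u) w + g u v * g u w - g u u * g v w := by
    intro u v w
    have h1 := star u (v + w)
    have h2 := star u v
    have h3 := star u w
    simp only [map_add, LinearMap.add_apply, hs w v] at h1
    linear_combination (h1 - h2 - h3) / 2
  have neg : ∀ u, g (S u) (S u) = - g u u := by
    intro u
    by_cases hu : S u = 0
    · have : u = 0 := by
        apply nd
        intro v
        apply Complex.ext
        · rw [← hSd, hu]; simp
        · rw [← hTd, hT, hu]; simp
      simp [this]
    · obtain ⟨w, hw⟩ : ∃ w, g (S u) w ≠ 0 := by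
        by_contra! hc
        exact hu (gn _ hc)
      have := pol u (S u) w
      have e1 : g (T u) (S u) = 0 := by rw [hs, hT, zI]
      have e2 : g (I u) (S u) = 0 := by rw [kI, ← hT, zT]; simp
      rw [e1, e2, zS] at this
      apply mul_right_cancel₀ hw
      linarith
  have hS : ∀ v, S (S v) = v := by
    intro v
    apply gext
    intro w
    have h1 := neg (v + w)
    have h2 := neg v
    have h3 := neg w
    simp only [map_add, LinearMap.add_apply, hs w v, hs (S w) (S v)] at h1
    rw [kS]
    linarith
  have hTT : ∀ v, T (T v) = v := by
    intro v
    rw [hT, hT, hIS, hI]; simp [hS]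
  refine ⟨g, S, T, ⟨?_, hI, hS, hTT, hT, hIS, kI, kS, kT⟩, og,
    fun u v => (hSd u v).symm, fun u v => (hTd u v).symm⟩
  have hpos : ∃ e, 0 < g e e := by
    by_contra! hc
    have hz : ∀ u, g u u = 0 := by
      intro u
      have h1 := hc u
      have h2 := hc (S u)
      rw [neg] at h2
      linarith
    have : ∀ u : V, u = 0 := by
      intro u
      apply gn
      intro v
      have h1 := hz (u + v)
      simp [hz, hs v u] at h1
      linarith
    have : Subsingleton V := ⟨fun a b => by rw [this a, this b]⟩
    have := Module.finrank_zero_of_subsingleton (R := ℝ) (M := V)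
    omega
  obtain ⟨e, he⟩ := hpos
  have he1 : g ((Real.sqrt (g e e))⁻¹ • e) ((Real.sqrt (g e e))⁻¹ • e) = 1 := by
    simp only [map_smul, LinearMap.smul_apply, smul_eq_mul]
    have := Real.mul_self_sqrt he.le
    have h0 : Real.sqrt (g e e) ≠ 0 := (Real.sqrt_pos.mpr he).ne'
    field_simp
    nlinarith
  obtain ⟨b, -, -, -, -, hb⟩ := aph_basis hdim g I S T hs hI hS hT hIS kI kS _ he1
  exact ⟨b, hb⟩

set_option maxHeartbeats 4000000 in
lemma aph_to_forms (hdim : finrank ℝ V = 4) (g : V →ₗ[ℝ] V →ₗ[ℝ] ℝ) (I S T : V →ₗ[ℝ] V)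
    (h : IsAPHH g I S T) :
    ∃ (Ω : V →ₗ[ℝ] V →ₗ[ℝ] ℂ) (ω : V →ₗ[ℝ] V →ₗ[ℝ] ℝ), FormsCond I Ω ω := by
  obtain ⟨⟨f, fo, f0, f1, f2, f3⟩, hI, hS, hTT, hT, hIS, kI, kS, kT⟩ := h
  have hs : ∀ u v, g u v = g v u := by
    have : g = g.flip := by
      refine f.ext fun i => f.ext fun j => ?_
      by_cases hij : i = j
      · subst hij; rfl
      · rw [LinearMap.flip_apply, fo i j hij, fo j i (Ne.symm hij)]
    intro u v
    conv_lhs => rw [this]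
    rfl
  obtain ⟨b, b0, b1, b2, b3, bo, g0, g1, g2, g3⟩ :=
    aph_basis hdim g I S T hs hI hS hT hIS kI kS _ f0
  set e := f 0
  have hSI : ∀ v, S (I v) = - T v := fun v => by rw [hT, hIS]; simp
  have hTI : ∀ v, T (I v) = S v := fun v => by rw [hT, hSI, hT]; simp [hI]
  have hIT : ∀ v, I (T v) = - S v := fun v => by rw [hT, hI]
  have hST : ∀ v, S (T v) = - I v := fun v => by
    have := hSI (S v)
    rw [← hT] at this
    rw [this, hT, hS]
  have hTS : ∀ v, T (S v) = I v := fun v => by rw [hT, hS]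
  have zI : ∀ u, g (I u) u = 0 := fun u => by have := kI u u; rw [hs u] at this; linarith
  have zS : ∀ u, g (S u) u = 0 := fun u => by have := kS u u; rw [hs u] at this; linarith
  have zT : ∀ u, g (T u) u = 0 := fun u => by have := kT u u; rw [hs u] at this; linarith
  have ex : ∀ v, ∃ x y z w : ℝ, v = x • e + y • I e + z • S e + w • T e := by
    intro v
    refine ⟨b.repr v 0, b.repr v 1, b.repr v 2, b.repr v 3, ?_⟩
    conv_lhs => rw [← b.sum_repr v]
    rw [Fin.sum_univ_four, b0, b1, b2, b3]
  have q01 := bo 0 1 (by decide)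
  have q02 := bo 0 2 (by decide)
  have q03 := bo 0 3 (by decide)
  have q10 := bo 1 0 (by decide)
  have q12 := bo 1 2 (by decide)
  have q13 := bo 1 3 (by decide)
  have q20 := bo 2 0 (by decide)
  have q21 := bo 2 1 (by decide)
  have q23 := bo 2 3 (by decide)
  have q30 := bo 3 0 (by decide)
  have q31 := bo 3 1 (by decide)
  have q32 := bo 3 2 (by decide)
  simp only [b0, b1, b2, b3] at g0 g1 g2 g3 q01 q02 q03 q10 q12 q13 q20 q21 q23 q30 q31 q32
  have gexp : ∀ x y z w x' y' z' w' : ℝ, g (x • e + y • I e + z • S e + w • T e)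
      (x' • e + y' • I e + z' • S e + w' • T e) = x * x' + y * y' - z * z' - w * w' := by
    intros
    simp only [map_add, map_smul, LinearMap.add_apply, LinearMap.smul_apply, smul_eq_mul,
      g0, g1, g2, g3, q01, q02, q03, q10, q12, q13, q20, q21, q23, q30, q31, q32]
    ring
  have eI : ∀ x y z w : ℝ, I (x • e + y • I e + z • S e + w • T e)
      = (-y) • e + x • I e + (-w) • S e + z • T e := by
    intros
    simp only [map_add, map_smul, hI, hIT, ← hT]
    module
  have eS : ∀ x y z w : ℝ, S (x • e + y • I e + z • S e + w • T e)
      = z • e + (-w) • I e + x • S e + (-y) • T e := by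
    intros
    simp only [map_add, map_smul, hS, hST, hSI]
    module
  have eT : ∀ x y z w : ℝ, T (x • e + y • I e + z • S e + w • T e)
      = w • e + z • I e + y • S e + x • T e := by
    intros
    simp only [map_add, map_smul, hTT, hTS, hTI]
    module
  let Ω : V →ₗ[ℝ] V →ₗ[ℝ] ℂ :=
    (g ∘ₗ S).compr₂ Complex.ofRealCLM.toLinearMap
      + (g ∘ₗ T).compr₂ (Complex.I • Complex.ofRealCLM.toLinearMap)
  have hΩ : ∀ u v, Ω u v = ⟨g (S u) v, g (T u) v⟩ := by
    intro u v
    apply Complex.ext <;> simp [Ω]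
  have hω : ∀ u v, (g ∘ₗ I) u v = g (I u) v := fun u v => rfl
  refine ⟨Ω, g ∘ₗ I, ?_, ?_, ?_, ?_, ?_, ?_⟩
  · intro v
    rw [hΩ, zS, zT]; rfl
  · intro u v
    rw [hΩ, hΩ, hSI, hTI]
    apply Complex.ext <;> simp
  · intro v
    rw [hω, zI]
  · intro u hu
    obtain ⟨x, y, z, w, rfl⟩ := ex u
    have c := hu ((-y) • e + x • I e + w • S e + (-z) • T e)
    rw [hω, eI, gexp] at c
    have hx : x = 0 := mul_self_eq_zero.mp (by linarith [mul_self_nonneg x, mul_self_nonneg y, mul_self_nonneg z, mul_self_nonneg w])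
    have hy : y = 0 := mul_self_eq_zero.mp (by linarith [mul_self_nonneg x, mul_self_nonneg y, mul_self_nonneg z, mul_self_nonneg w])
    have hz : z = 0 := mul_self_eq_zero.mp (by linarith [mul_self_nonneg x, mul_self_nonneg y, mul_self_nonneg z, mul_self_nonneg w])
    have hw : w = 0 := mul_self_eq_zero.mp (by linarith [mul_self_nonneg x, mul_self_nonneg y, mul_self_nonneg z, mul_self_nonneg w])
    simp [hx, hy, hz, hw]
  · intro v₁ v₂ v₃ v₄
    obtain ⟨x1, y1, z1, w1, rfl⟩ := ex v₁
    obtain ⟨x2, y2, z2, w2, rfl⟩ := ex v₂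
    obtain ⟨x3, y3, z3, w3, rfl⟩ := ex v₃
    obtain ⟨x4, y4, z4, w4, rfl⟩ := ex v₄
    simp only [wedgeC, hΩ, hω, eI, eS, eT, gexp]
    apply Complex.ext
    · simp
      ring
    · simp
      ring
  · intro v₁ v₂ v₃ v₄
    obtain ⟨x1, y1, z1, w1, rfl⟩ := ex v₁
    obtain ⟨x2, y2, z2, w2, rfl⟩ := ex v₂
    obtain ⟨x3, y3, z3, w3, rfl⟩ := ex v₃
    obtain ⟨x4, y4, z4, w4, rfl⟩ := ex v₄
    simp only [wedgeC, hΩ, hω, eI, eS, eT, gexp]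
    apply Complex.ext
    · simp
      ring
    · simp
      ring

end helpers

/-- Lemma 2 (`APHHS`): a complex structure `I` on a 4-dimensional real vector space
belongs to an almost para-hyperhermitian structure `(g, I, S, T)` iff there exist a
`(2,0)`-form `Ω` and a nondegenerate real 2-form `ω` with `Ω ∧ Ω̄ = -2 ω²` and
`Ω ∧ ω = 0`; in that case the structure may be chosen with fundamental forms
`ω = g(I·,·)`, `Re Ω = g(S·,·)`, `Im Ω = g(T·,·)`. -/
theorem aphh_iff_forms {V : Type*} [AddCommGroup V] [Module ℝ V]
    (hdim : finrank ℝ V = 4)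
    (I : V →ₗ[ℝ] V) (hI : ∀ v, I (I v) = -v) :
    ((∃ g S T, IsAPHH g I S T) ↔
      ∃ (Ω : V →ₗ[ℝ] V →ₗ[ℝ] ℂ) (ω : V →ₗ[ℝ] V →ₗ[ℝ] ℝ), FormsCond I Ω ω) ∧
    (∀ (Ω : V →ₗ[ℝ] V →ₗ[ℝ] ℂ) (ω : V →ₗ[ℝ] V →ₗ[ℝ] ℝ), FormsCond I Ω ω →
      ∃ g S T, IsAPHH g I S T ∧
        (∀ u v, ω u v = g (I u) v) ∧
        (∀ u v, (Ω u v).re = g (S u) v) ∧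
        (∀ u v, (Ω u v).im = g (T u) v)) := by
  have key := forms_to_aph hdim I hI
  refine ⟨⟨?_, ?_⟩, key⟩
  · rintro ⟨g, S, T, h⟩
    exact aph_to_forms hdim g I S T h
  · rintro ⟨Ω, ω, h⟩
    obtain ⟨g, S, T, h, -⟩ := key Ω ω h
    exact ⟨g, S, T, h⟩
end
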